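/- Let T be a positive integer, let s ∈ ℝ^T be fixed, and let K : ℝ → (T×T real matrices) be differentiable at ρ₀, with K(ρ₀) symmetric positive definite and K(ρ) invertible with positive determinant in a neighborhood of ρ₀. Define the Gaussian process energy E(ρ) = (1/2)[log(det K(ρ)) + sᵀ K(ρ)⁻¹ s]. Then E is differentiable at ρ₀ with derivative E′(ρ₀) = (1/2) trace(K(ρ₀)⁻¹ K′(ρ₀)) − (1/2) sᵀ K(ρ₀)⁻¹ K′(ρ₀) K(ρ₀)⁻¹ s. -/

import Mathlib

open Matrix Filter

namespace Matrix

variable {n : Type*} [Fintype n]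

theorem hasDerivAt_dotProduct_mulVec {A : ℝ → Matrix n n ℝ} {A' : Matrix n n ℝ} {t : ℝ}
    (hA : ∀ i j, HasDerivAt (fun x => A x i j) (A' i j) t) (v w : n → ℝ) :
    HasDerivAt (fun x => v ⬝ᵥ A x *ᵥ w) (v ⬝ᵥ A' *ᵥ w) t := by
  simp only [dotProduct, mulVec]
  exact HasDerivAt.fun_sum fun i _ => (HasDerivAt.fun_sum fun j _ =>
    (hA i j).mul_const (w j)).const_mul (v i)

variable [DecidableEq n]

/-- **Jacobi's formula** for the derivative of a determinant. -/
theorem hasDerivAt_det {K : ℝ → Matrix n n ℝ} {K' : Matrix n n ℝ} {t : ℝ}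
    (hK : ∀ i j, HasDerivAt (fun x => K x i j) (K' i j) t) :
    HasDerivAt (fun x => (K x).det) ((K t).adjugate * K').trace t := by
  have hdet : HasDerivAt (fun x => (K x).det)
      (∑ σ : Equiv.Perm n, ((Equiv.Perm.sign σ : ℤ) : ℝ) *
        ∑ i, (∏ j ∈ Finset.univ.erase i, K t (σ j) j) • K' (σ i) i) t := by
    simp only [det_apply']
    exact HasDerivAt.fun_sum fun σ _ =>
      (HasDerivAt.fun_finsetProd fun i _ => hK (σ i) i).const_mul _
  convert hdet using 1
  have hentry (i : n) : ((K t).adjugate * K') i i =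
      ((K t).updateCol i fun k => K' k i).det := by
    rw [← cramer_apply, cramer_eq_adjugate_mulVec]
    rfl
  simp only [trace, diag_apply, hentry, det_apply', Finset.mul_sum, smul_eq_mul]
  rw [Finset.sum_comm]
  refine Finset.sum_congr rfl fun σ _ => Finset.sum_congr rfl fun i _ => ?_
  rw [← Finset.mul_prod_erase _ _ (Finset.mem_univ i), updateCol_self, mul_comm (K' _ _)]
  congr 2
  exact Finset.prod_congr rfl fun j hj => updateCol_ne (Finset.ne_of_mem_erase hj)

section

attribute [local instance] Matrix.linftyOpNormedRing Matrix.linftyOpNormedAlgebra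

theorem hasDerivAt_inv_apply {K : ℝ → Matrix n n ℝ} {K' : Matrix n n ℝ} {t : ℝ}
    (hK : ∀ i j, HasDerivAt (fun x => K x i j) (K' i j) t) (hu : IsUnit (K t)) (i j : n) :
    HasDerivAt (fun x => (K x)⁻¹ i j) (-((K t)⁻¹ * K' * (K t)⁻¹) i j) t := by
  have hKt : HasDerivAt K K' t := hasDerivAt_pi.2 fun i => hasDerivAt_pi.2 fun j => hK i j
  obtain ⟨u, hu⟩ := hu
  have hinv := hasFDerivAt_ringInverse (𝕜 := ℝ) u
  rw [hu] at hinv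
  have hcomp := hinv.comp_hasDerivAt t hKt
  have hentry := hasDerivAt_pi.1 (hasDerivAt_pi.1 hcomp i) j
  simpa [Function.comp_def, ← nonsing_inv_eq_ringInverse, hu] using hentry

end

end Matrix

/-- **Hyperparameter derivative of the Gaussian process energy.**
For fixed `s ∈ ℝ^T` and `K : ℝ → Matrix (Fin T) (Fin T) ℝ` differentiable at `ρ₀`
(entrywise, with derivative matrix `K'`), with `K ρ₀` symmetric positive definite
and `K ρ` invertible with positive determinant near `ρ₀`, the GP energy
`E(ρ) = (1/2)[log det K(ρ) + sᵀ K(ρ)⁻¹ s]` is differentiable at `ρ₀` with derivative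
`(1/2) tr(K(ρ₀)⁻¹ K') − (1/2) sᵀ K(ρ₀)⁻¹ K' K(ρ₀)⁻¹ s`. -/
theorem hasDerivAt_gp_energy
    (T : ℕ) (hT : 0 < T) (s : Fin T → ℝ)
    (K : ℝ → Matrix (Fin T) (Fin T) ℝ)
    (K' : Matrix (Fin T) (Fin T) ℝ) (ρ₀ : ℝ)
    (hK : ∀ i j, HasDerivAt (fun ρ => K ρ i j) (K' i j) ρ₀)
    (hpos : (K ρ₀).PosDef)
    (hinv : ∀ᶠ ρ in nhds ρ₀, IsUnit (K ρ).det ∧ 0 < (K ρ).det) :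
    HasDerivAt
      (fun ρ => (1 / 2 : ℝ) * (Real.log (K ρ).det + s ⬝ᵥ (K ρ)⁻¹.mulVec s))
      ((1 / 2 : ℝ) * ((K ρ₀)⁻¹ * K').trace
        - (1 / 2 : ℝ) * (s ⬝ᵥ ((K ρ₀)⁻¹ * K' * (K ρ₀)⁻¹).mulVec s)) ρ₀ := by
  have hdet : 0 < (K ρ₀).det := hpos.det_pos
  have hlog := (hasDerivAt_det hK).log hdet.ne'
  have hquad := hasDerivAt_dotProduct_mulVec (A' := -((K ρ₀)⁻¹ * K' * (K ρ₀)⁻¹))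
    (hasDerivAt_inv_apply hK hpos.isUnit) s s
  refine ((hlog.add hquad).const_mul (1 / 2 : ℝ)).congr_deriv ?_
  have htrace : ((K ρ₀)⁻¹ * K').trace = ((K ρ₀).adjugate * K').trace / (K ρ₀).det := by
    rw [inv_def, Ring.inverse_eq_inv', smul_mul, trace_smul, smul_eq_mul, inv_mul_eq_div]
  rw [htrace, neg_mulVec, dotProduct_neg]
  ring
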